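/- Correctness of the coNP-hardness reduction for LTL(X) model checking: let φ = ⋀_{i=1}^m (ℓ_{i,1} ∨ ℓ_{i,2} ∨ ℓ_{i,3}) be a propositional 3CNF formula over variables x₁,…,x_n (each ℓ_{i,t} a literal x_j or ¬x_j), and define the LTL(X) formula ψ_X := ⋁_{i=1}^m (χ(ℓ_{i,1}) ∧ χ(ℓ_{i,2}) ∧ χ(ℓ_{i,3})), where χ(x_j) := ¬X^j x_j and χ(¬x_j) := X^j x_j (X^j denoting j nested X operators). Then every path π of the assignment structure S_n with π 0 = w₀ satisfies (S_n, π) ⊨ ψ_X if and only if φ is unsatisfiable as a propositional formula. -/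

import Mathlib

inductive LTL (P : Type) : Type
  | atom : P → LTL P
  | neg  : LTL P → LTL P
  | conj : LTL P → LTL P → LTL P
  | disj : LTL P → LTL P → LTL P
  | next : LTL P → LTL P
  | fut  : LTL P → LTL P
  | glob : LTL P → LTL P
  | untl : LTL P → LTL P → LTL P

structure Kripke (P W : Type) where
  R : W → W → Prop
  V : W → Set P

/-- Totality of the transition relation: every world has a successor. -/
def Kripke.Total {P W : Type} (A : Kripke P W) : Prop := ∀ w, ∃ w', A.R w w'

/-- A path in a Kripke structure. -/
def IsPath {P W : Type} (A : Kripke P W) (π : ℕ → W) : Prop := ∀ i, A.R (π i) (π (i + 1))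

/-- LTL satisfaction over a Kripke structure and a path. -/
def Sat {P W : Type} (A : Kripke P W) : LTL P → (ℕ → W) → Prop
  | .atom p, π => p ∈ A.V (π 0)
  | .neg φ, π => ¬ Sat A φ π
  | .conj φ ψ, π => Sat A φ π ∧ Sat A ψ π
  | .disj φ ψ, π => Sat A φ π ∨ Sat A ψ π
  | .next φ, π => Sat A φ (fun i => π (i + 1))
  | .fut φ, π => ∃ k, Sat A φ (fun i => π (k + i))
  | .glob φ, π => ∀ k, Sat A φ (fun i => π (k + i))
  | .untl φ ψ, π => ∃ k, Sat A ψ (fun i => π (k + i)) ∧ ∀ j < k, Sat A φ (fun i => π (j + i))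

/-- Worlds of the assignment structure `S_n`: `none` is `w₀`, `some (i, b)` is the world `(i, b)`
(only `1 ≤ i ≤ n` is actually reachable). Propositions are natural numbers; `x_i` is `i`. -/
abbrev SnW : Type := Option (ℕ × Bool)

/-- Transition relation of `S_n`. -/
def SnR (n : ℕ) : SnW → SnW → Prop
  | none, some (i, _) => i = 1
  | some (i, b), some (j, b') => (1 ≤ i ∧ i < n ∧ j = i + 1) ∨ (i = n ∧ j = n ∧ b' = b)
  | _, _ => False

/-- Valuation of `S_n`: world `(i, true)` is labeled with `x_i`. -/
def SnV (n : ℕ) : SnW → Set ℕ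
  | some (i, true) => if 1 ≤ i ∧ i ≤ n then {i} else ∅
  | _ => ∅

/-- The assignment structure `S_n`. -/
def Sn (n : ℕ) : Kripke ℕ SnW := ⟨SnR n, SnV n⟩

/-- `bigOr f m` is the disjunction `f 0 ∨ f 1 ∨ … ∨ f m`. -/
def bigOr {P : Type} (f : ℕ → LTL P) : ℕ → LTL P
  | 0 => f 0
  | m + 1 => .disj (bigOr f m) (f (m + 1))

/-- `Xpow i φ` is `X^i φ`, i.e. `i` nested next operators applied to `φ`. -/
def Xpow {P : Type} : ℕ → LTL P → LTL P
  | 0, φ => φ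
  | i + 1, φ => .next (Xpow i φ)

/-- `χ` of a literal (variable index, polarity): `χ(x_j) = ¬X^j x_j`, `χ(¬x_j) = X^j x_j`. -/
def chiX (l : ℕ × Bool) : LTL ℕ :=
  if l.2 then .neg (Xpow l.1 (.atom l.1)) else Xpow l.1 (.atom l.1)

/-- The LTL(X) formula `ψ_X = ⋁_{i=1}^m (χ(ℓ_{i,1}) ∧ χ(ℓ_{i,2}) ∧ χ(ℓ_{i,3}))`
(clauses indexed `0,…,m-1`). -/
def psiX (lit : ℕ → ℕ → ℕ × Bool) (m : ℕ) : LTL ℕ :=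
  bigOr (fun i => .conj (chiX (lit i 0)) (.conj (chiX (lit i 1)) (chiX (lit i 2)))) (m - 1)

/-- A literal `(j, pol)` is true under assignment `α` iff `α j = pol`. -/
def litTrue (α : ℕ → Bool) (l : ℕ × Bool) : Prop := α l.1 = l.2

theorem sat_bigOr {P W : Type} (A : Kripke P W) (f : ℕ → LTL P) (m : ℕ) (π : ℕ → W) :
    Sat A (bigOr f m) π ↔ ∃ i ≤ m, Sat A (f i) π := by
  induction m with
  | zero => simp [bigOr]
  | succ k ih =>
    simp only [bigOr, Sat, ih]
    constructor
    · rintro (⟨i, hi, h⟩ | h)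
      · exact ⟨i, by omega, h⟩
      · exact ⟨k + 1, le_rfl, h⟩
    · rintro ⟨i, hi, h⟩
      rcases Nat.lt_or_ge k i with h1 | h1
      · obtain rfl : i = k + 1 := by omega
        exact Or.inr h
      · exact Or.inl ⟨i, h1, h⟩

theorem sat_Xpow {P W : Type} (A : Kripke P W) (φ : LTL P) (j : ℕ) (π : ℕ → W) :
    Sat A (Xpow j φ) π ↔ Sat A φ (fun i => π (i + j)) := by
  induction j generalizing π with
  | zero => simp [Xpow]
  | succ k ih =>
    simp only [Xpow, Sat, ih]
    rfl

theorem sat_chiX (n : ℕ) (π : ℕ → SnW) (α : ℕ → Bool) (l : ℕ × Bool)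
    (h : l.1 ∈ (Sn n).V (π l.1) ↔ α l.1 = true) :
    Sat (Sn n) (chiX l) π ↔ ¬ litTrue α l := by
  obtain ⟨j, b⟩ := l
  cases b <;> simp_all [chiX, litTrue, Sat, sat_Xpow]

theorem sat_psiX (n m : ℕ) (hm : 1 ≤ m) (lit : ℕ → ℕ → ℕ × Bool) (π : ℕ → SnW) (α : ℕ → Bool)
    (h : ∀ i < m, ∀ t < 3, ((lit i t).1 ∈ (Sn n).V (π (lit i t).1) ↔ α (lit i t).1 = true)) :
    Sat (Sn n) (psiX lit m) π ↔ ¬ ∀ i < m,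
        litTrue α (lit i 0) ∨ litTrue α (lit i 1) ∨ litTrue α (lit i 2) := by
  rw [psiX, sat_bigOr]
  push Not
  refine exists_congr fun i => ?_
  have e : i ≤ m - 1 ↔ i < m := by omega
  rw [e]
  refine and_congr_right fun hi => ?_
  simp only [Sat]
  rw [sat_chiX n π α _ (h i hi 0 (by omega)), sat_chiX n π α _ (h i hi 1 (by omega)),
    sat_chiX n π α _ (h i hi 2 (by omega))]

/-- every path of `S_n` from `w₀` satisfies `ψ_X` iff the 3CNF `φ` is
unsatisfiable. -/
theorem ltl_next_mc_conp_reduction (n m : ℕ) (hn : 1 ≤ n) (hm : 1 ≤ m)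
    (lit : ℕ → ℕ → ℕ × Bool)
    (hlit : ∀ i < m, ∀ t < 3, 1 ≤ (lit i t).1 ∧ (lit i t).1 ≤ n) :
    (∀ π : ℕ → SnW, IsPath (Sn n) π → π 0 = none → Sat (Sn n) (psiX lit m) π) ↔
    ¬ ∃ α : ℕ → Bool, ∀ i < m,
        litTrue α (lit i 0) ∨ litTrue α (lit i 1) ∨ litTrue α (lit i 2) := by
  classical
  constructor
  · rintro H ⟨α, hα⟩
    let π : ℕ → SnW := fun i => if i = 0 then none else some (min i n, α (min i n))
    have hp : IsPath (Sn n) π := by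
      intro i
      rcases Nat.eq_zero_or_pos i with rfl | hi
      · simp [π, Sn, SnR, hn]
      · have h0 : i ≠ 0 := by omega
        simp only [π, Sn, h0, if_false, Nat.succ_ne_zero, SnR]
        rcases Nat.lt_or_ge i n with h1 | h1
        · left; omega
        · right
          rw [min_eq_right h1, min_eq_right (by omega : n ≤ i + 1)]
          simp
    refine (sat_psiX n m hm lit π α ?_).1 (H π hp (by simp [π])) hα
    intro i hi t ht
    obtain ⟨h1, h2⟩ := hlit i hi t ht
    generalize (lit i t).1 = j at *
    have h0 : j ≠ 0 := by omega
    simp only [π, h0, if_false, min_eq_left h2, Sn]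
    cases α j <;> simp [SnV, h1, h2]
  · intro H π _ _
    refine (sat_psiX n m hm lit π (fun j => decide (j ∈ (Sn n).V (π j))) ?_).2
      fun h => H ⟨_, h⟩
    intros
    simp
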